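/- arXiv:0801.0394 — 4 statements merged into one kernel-verified Lean document; each statement's English description precedes it below -/
import Mathlib

section
/- Let c, d be constants with 0 < 8d ≤ c ≤ 1/100 and d ≤ 1/240. Let R be an oriented graph on k vertices with δ⁰(R) ≥ (3/8 − 2d)k, and suppose S is a set of vertices of R with k/3 < |S| < 2k/3 and |N⁺_R(S)| < |S| + 2ck. Define A_R := S ∩ N⁺_R(S), B_R := N⁺_R(S)∖S, C_R := V(R)∖(S ∪ N⁺_R(S)) and D_R := S∖N⁺_R(S). Then ||A_R| − k/4| ≤ 30ck, ||B_R| − k/4| ≤ 10ck, ||C_R| − k/4| ≤ 30ck and ||D_R| − k/4| ≤ 5ck. -/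
open Set

namespace ArxivOG

variable {V : Type*}

/-- An oriented graph: at most one directed edge between any two vertices (and no loops). -/
def IsOriented (G : V → V → Prop) : Prop := ∀ x y : V, G x y → ¬ G y x

/-- Out-neighbourhood of a vertex. -/
def outN (G : V → V → Prop) (x : V) : Set V := {y | G x y}

/-- In-neighbourhood of a vertex. -/
def inN (G : V → V → Prop) (x : V) : Set V := {y | G y x}

/-- Outdegree of a vertex. -/
noncomputable def outDeg (G : V → V → Prop) (x : V) : ℕ := (outN G x).ncard

/-- Indegree of a vertex. -/
noncomputable def inDeg (G : V → V → Prop) (x : V) : ℕ := (inN G x).ncard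

/-- The set of all outneighbours of vertices in `S`. -/
def outNSet (G : V → V → Prop) (S : Set V) : Set V := {y | ∃ x ∈ S, G x y}

/-- Minimum outdegree `δ⁺`. -/
noncomputable def minOutDeg (G : V → V → Prop) : ℕ := sInf (Set.range (outDeg G))

/-- Minimum indegree `δ⁻`. -/
noncomputable def minInDeg (G : V → V → Prop) : ℕ := sInf (Set.range (inDeg G))

/-- Minimum semi-degree `δ⁰ = min (δ⁺, δ⁻)`. -/
noncomputable def minSemiDeg (G : V → V → Prop) : ℕ := min (minOutDeg G) (minInDeg G)

/-- A Hamilton cycle of a digraph, encoded as a permutation `σ` of the vertex set all of whose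
vertices lie on a single cycle and such that every vertex sends an edge to its successor. -/
def IsHamCycle (G : V → V → Prop) (σ : Equiv.Perm V) : Prop :=
  (∀ v, G v (σ v)) ∧ ∀ v w : V, σ.SameCycle v w

/-- The number of edges directed from `A` to `B`. -/
noncomputable def eCnt (G : V → V → Prop) (A B : Set V) : ℕ :=
  {p : V × V | p.1 ∈ A ∧ p.2 ∈ B ∧ G p.1 p.2}.ncard

/-- The density of the bipartite graph of all `A`–`B` edges. -/
noncomputable def dens (G : V → V → Prop) (A B : Set V) : ℝ :=
  (eCnt G A B : ℝ) / ((A.ncard : ℝ) * (B.ncard : ℝ))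

/-- The pair `(A,B)` is `ε`-regular. -/
def EpsRegular (ε : ℝ) (G : V → V → Prop) (A B : Set V) : Prop :=
  ∀ X ⊆ A, ∀ Y ⊆ B, ε * A.ncard < (X.ncard : ℝ) → ε * B.ncard < (Y.ncard : ℝ) →
    |dens G X Y - dens G A B| < ε

/-- The pair `(A,B)` is `(ε,d)`-super-regular. -/
def SuperRegular (ε d : ℝ) (G : V → V → Prop) (A B : Set V) : Prop :=
  EpsRegular ε G A B ∧
  (∀ a ∈ A, (d - ε) * B.ncard ≤ ((outN G a ∩ B).ncard : ℝ)) ∧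
  (∀ b ∈ B, (d - ε) * A.ncard ≤ ((inN G b ∩ A).ncard : ℝ))

/-- The cluster `V_i` of a partition encoded by `P : V → Option (Fin k)`. -/
def cluster {k : ℕ} (P : V → Option (Fin k)) (i : Fin k) : Set V := {x | P x = some i}

/-- The exceptional set `V₀` of a partition encoded by `P : V → Option (Fin k)`. -/
def cluster0 {k : ℕ} (P : V → Option (Fin k)) : Set V := {x | P x = none}

/-- In an oriented graph, every nonempty vertex set contains a vertex whose outdegree inside the
set is at most half the size of the set. -/
lemma IsOriented.exists_two_mul_ncard_outN_inter_le [Finite V] {G : V → V → Prop}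
    (hG : IsOriented G) {A : Set V} (hA : A.Nonempty) :
    ∃ x ∈ A, 2 * (outN G x ∩ A).ncard ≤ A.ncard := by
  classical
  have := Fintype.ofFinite V
  by_contra! h
  have hdeg : ∀ x, (outN G x ∩ A).ncard + (inN G x ∩ A).ncard ≤ A.ncard := fun x => by
    rw [← Set.ncard_union_eq
      (Set.disjoint_left.2 fun y hy hy' => hG x y hy.1 hy'.1)]
    exact Set.ncard_le_ncard (Set.union_subset Set.inter_subset_right Set.inter_subset_right)
  have hout : ∀ x, (outN G x ∩ A).ncard = (A.toFinset.bipartiteAbove G x).card := fun x => by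
    rw [← Set.ncard_coe_finset]
    congr 1
    ext y
    simp [outN, Finset.bipartiteAbove, and_comm]
  have hin : ∀ x, (inN G x ∩ A).ncard = (A.toFinset.bipartiteBelow G x).card := fun x => by
    rw [← Set.ncard_coe_finset]
    congr 1
    ext y
    simp [inN, Finset.bipartiteBelow, and_comm]
  have hsum : ∑ x ∈ A.toFinset, (outN G x ∩ A).ncard
      = ∑ x ∈ A.toFinset, (inN G x ∩ A).ncard := by
    simp only [hout, hin]
    exact Finset.sum_card_bipartiteAbove_eq_sum_card_bipartiteBelow G
  have hlt : ∑ x ∈ A.toFinset, (inN G x ∩ A).ncard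
      < ∑ x ∈ A.toFinset, (outN G x ∩ A).ncard := by
    refine Finset.sum_lt_sum_of_nonempty (by simpa using hA) fun x hx => ?_
    have h₁ := h x (by simpa using hx)
    have h₂ := hdeg x
    omega
  exact hlt.ne' hsum

/-- If every outneighbour of a vertex of the nonempty set `A` lies in `A ∪ B`, then a lower bound
`m` on the outdegrees forces `m ≤ |B| + |A| / 2`. -/
lemma IsOriented.le_ncard_add_half_ncard [Finite V] {G : V → V → Prop} (hG : IsOriented G)
    {A B : Set V} (hA : A.Nonempty) {m : ℝ} (hm : ∀ x ∈ A, m ≤ outDeg G x)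
    (hsub : ∀ x ∈ A, outN G x ⊆ A ∪ B) : m ≤ B.ncard + (A.ncard : ℝ) / 2 := by
  obtain ⟨x, hx, hle⟩ := hG.exists_two_mul_ncard_outN_inter_le hA
  have hcover : outN G x ⊆ (outN G x ∩ A) ∪ B := fun y hy =>
    (hsub x hx hy).imp (fun h => ⟨hy, h⟩) id
  have hcard : outDeg G x ≤ (outN G x ∩ A).ncard + B.ncard :=
    (Set.ncard_le_ncard hcover).trans (Set.ncard_union_le _ _)
  have hcard' : (outDeg G x : ℝ) ≤ (outN G x ∩ A).ncard + B.ncard := by exact_mod_cast hcard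
  have hle' : 2 * ((outN G x ∩ A).ncard : ℝ) ≤ A.ncard := by exact_mod_cast hle
  linarith [hm x hx]

/-- A vertex of an oriented graph with no neighbours in `D` has total degree at most
`|V| - |D|`. -/
lemma IsOriented.outDeg_add_inDeg_add_ncard_le [Finite V] {G : V → V → Prop} (hG : IsOriented G)
    {D : Set V} {x : V} (hout : outN G x ⊆ Dᶜ) (hin : inN G x ⊆ Dᶜ) :
    outDeg G x + inDeg G x + D.ncard ≤ Nat.card V := by
  have hdisj : Disjoint (outN G x) (inN G x) :=
    Set.disjoint_left.2 fun y hy hy' => hG x y hy hy'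
  rw [outDeg, inDeg, ← Set.ncard_union_eq hdisj, ← Set.ncard_add_ncard_compl D, add_comm]
  exact Nat.add_le_add_left (Set.ncard_le_ncard (Set.union_subset hout hin)) _

/-- **Claim 2.1 (sizes of the parts in the extremal case).**
Let `0 < 8d ≤ c ≤ 1/100` and `d ≤ 1/240`. If `R` is an oriented graph on `k` vertices with
`δ⁰(R) ≥ (3/8 - 2d)k` and `S` is a vertex set with `k/3 < |S| < 2k/3` and
`|N⁺(S)| < |S| + 2ck`, then the four parts `A_R = S ∩ N⁺(S)`, `B_R = N⁺(S) ∖ S`,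
`C_R = [k] ∖ (S ∪ N⁺(S))` and `D_R = S ∖ N⁺(S)` all have size close to `k/4`. -/
theorem part_sizes_in_extremal_case :
    ∀ c d : ℝ, 0 < d → 8 * d ≤ c → c ≤ 1 / 100 → d ≤ 1 / 240 →
    ∀ k : ℕ, ∀ R : Fin k → Fin k → Prop, IsOriented R →
    (∀ i : Fin k, (3 / 8 - 2 * d) * k ≤ (min (outDeg R i) (inDeg R i) : ℝ)) →
    ∀ S : Set (Fin k),
    (k : ℝ) / 3 < (S.ncard : ℝ) → (S.ncard : ℝ) < 2 * k / 3 →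
    ((outNSet R S).ncard : ℝ) < (S.ncard : ℝ) + 2 * c * k →
    |(((S ∩ outNSet R S).ncard : ℝ)) - (k : ℝ) / 4| ≤ 30 * c * k ∧
    |(((outNSet R S \ S).ncard : ℝ)) - (k : ℝ) / 4| ≤ 10 * c * k ∧
    |((((S ∪ outNSet R S)ᶜ).ncard : ℝ)) - (k : ℝ) / 4| ≤ 30 * c * k ∧
    |(((S \ outNSet R S).ncard : ℝ)) - (k : ℝ) / 4| ≤ 5 * c * k := by
  intro c d hd hdc hc hd' k R hR hdeg S hS₁ hS₂ hN
  have hout : ∀ i, (3 / 8 - 2 * d) * k ≤ (outDeg R i : ℝ) := fun i =>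
    (hdeg i).trans (min_le_left _ _)
  have hin : ∀ i, (3 / 8 - 2 * d) * k ≤ (inDeg R i : ℝ) := fun i =>
    (hdeg i).trans (min_le_right _ _)
  set N := outNSet R S
  have hmem : ∀ {x y}, x ∈ S → R x y → y ∈ N := fun hx hxy => ⟨_, hx, hxy⟩
  have hScard : ((S ∩ N).ncard : ℝ) + (S \ N).ncard = S.ncard := by
    exact_mod_cast Set.ncard_inter_add_ncard_sdiff_eq_ncard S N
  have hNcard : ((S ∩ N).ncard : ℝ) + (N \ S).ncard = N.ncard := by
    rw [Set.inter_comm]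
    exact_mod_cast Set.ncard_inter_add_ncard_sdiff_eq_ncard N S
  have hVcard : (S.ncard : ℝ) + (N \ S).ncard + ((S ∪ N)ᶜ).ncard = k := by
    have h₁ := Set.ncard_add_ncard_compl (S ∪ N)
    rw [← Set.union_sdiff_self, Set.ncard_union_eq Set.disjoint_sdiff_right,
      Nat.card_eq_fintype_card, Fintype.card_fin, Set.union_sdiff_self] at h₁
    exact_mod_cast h₁
  have hk : (0 : ℝ) < k := by linarith
  have hdk : 0 < d * k := mul_pos hd hk
  have hdck : 8 * (d * k) ≤ c * k := by nlinarith
  have hck : c * k ≤ k / 100 := by nlinarith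
  have hdk' : d * k ≤ k / 240 := by nlinarith
  have hD : ((S \ N).ncard : ℝ) ≤ k / 4 + 4 * (d * k) := by
    rcases (S \ N).eq_empty_or_nonempty with h | ⟨x, hxS, hxN⟩
    · rw [h, Set.ncard_empty, Nat.cast_zero]
      linarith
    · have h := hR.outDeg_add_inDeg_add_ncard_le (D := S \ N) (x := x)
        (fun y hy hyD => hyD.2 (hmem hxS hy)) (fun y hy hyD => hxN (hmem hyD.1 hy))
      rw [Nat.card_eq_fintype_card, Fintype.card_fin] at h
      have h' : (outDeg R x : ℝ) + inDeg R x + (S \ N).ncard ≤ k := by exact_mod_cast h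
      linarith [hout x, hin x]
  have hA : (3 / 8 - 2 * d) * k ≤ (N \ S).ncard + ((S ∩ N).ncard : ℝ) / 2 := by
    refine hR.le_ncard_add_half_ncard ?_ (fun x _ => hout x) fun x hx y hy => ?_
    · rw [Set.nonempty_iff_ne_empty]
      intro h
      rw [h, Set.ncard_empty, Nat.cast_zero] at hScard
      linarith
    · have hyN := hmem hx.1 hy
      by_cases hyS : y ∈ S
      · exact Or.inl ⟨hyS, hyN⟩
      · exact Or.inr ⟨hyN, hyS⟩
  have hC : (3 / 8 - 2 * d) * k ≤ (N \ S).ncard + (((S ∪ N)ᶜ).ncard : ℝ) / 2 := by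
    have hRflip : IsOriented (flip R) := fun x y h h' => hR x y h' h
    refine hRflip.le_ncard_add_half_ncard ?_ (fun x _ => hin x) fun x hx y hy => ?_
    · rw [Set.nonempty_iff_ne_empty]
      intro h
      rw [h, Set.ncard_empty, Nat.cast_zero] at hVcard
      linarith
    · have hyS : y ∉ S := fun h => hx (Or.inr (hmem h hy))
      by_cases hyN : y ∈ N
      · exact Or.inr ⟨hyN, hyS⟩
      · exact Or.inl fun h => h.elim hyS hyN
  refine ⟨abs_le.2 ⟨?_, ?_⟩, abs_le.2 ⟨?_, ?_⟩, abs_le.2 ⟨?_, ?_⟩, abs_le.2 ⟨?_, ?_⟩⟩ <;>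
    linarith

end ArxivOG
end

section
/- Let c, d be constants with 0 < d ≤ 1/100 and d² ≤ 2c. Let R be an oriented graph on k vertices with δ⁰(R) > (3/8 − 2d)k, and suppose that |N⁺_R(S)| ≥ |S| + 2ck for every set S of vertices with k/3 < |S| < 2k/3. Then: (1) |N⁺_R(S)| ≥ |S| + d²k for every set S with d²k < |S| < (1 − d²)k; (2) |N⁺_R(S)| ≥ |S| for every set S of vertices of R; and consequently (3) R has a 1-factor. -/
open Set

namespace ArxivOG

variable {V : Type*}

/-- A nonempty set has more outneighbours than any strict lower bound on the outdegrees. -/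
theorem lt_ncard_outNSet_of_forall_lt_outDeg [Finite V] {G : V → V → Prop} {m : ℝ}
    (hG : ∀ x, m < outDeg G x) {S : Set V} (hS : S.Nonempty) : m < (outNSet G S).ncard := by
  obtain ⟨x, hx⟩ := hS
  have h : outDeg G x ≤ (outNSet G S).ncard :=
    Set.ncard_le_ncard (fun y hy => ⟨x, hx, hy⟩) (Set.toFinite _)
  exact (hG x).trans_le (by exact_mod_cast h)

/-- A set whose complement is smaller than every indegree has every vertex as an outneighbour. -/
theorem outNSet_eq_univ [Finite V] {G : V → V → Prop} {S : Set V}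
    (hS : ∀ x, Sᶜ.ncard < inDeg G x) : outNSet G S = Set.univ := by
  refine Set.eq_univ_of_forall fun y => ?_
  by_contra hy
  have h : inN G y ⊆ Sᶜ := fun x hx hxS => hy ⟨x, hxS, hx⟩
  exact (hS y).not_ge (Set.ncard_le_ncard h (Set.toFinite _))

/-- Hall's condition on outneighbourhoods yields a 1-factor. -/
theorem exists_perm_of_ncard_le_ncard_outNSet [Finite V] {G : V → V → Prop}
    (hG : ∀ S : Set V, S.ncard ≤ (outNSet G S).ncard) :
    ∃ σ : Equiv.Perm V, ∀ v, G v (σ v) := by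
  classical
  have := Fintype.ofFinite V
  obtain ⟨f, hf, hfG⟩ := (Finset.all_card_le_biUnion_card_iff_exists_injective
    fun x => (outN G x).toFinset).1 fun s => by
      have h : outNSet G (s : Set V) = (s.biUnion fun x => (outN G x).toFinset : Finset V) := by
        ext y
        simp only [Finset.coe_biUnion, Set.mem_iUnion, Finset.mem_coe, Set.mem_toFinset, exists_prop]
        rfl
      have hs := hG s
      rwa [h, Set.ncard_coe_finset, Set.ncard_coe_finset] at hs
  exact ⟨Equiv.ofBijective f (Finite.injective_iff_bijective.1 hf),
    fun v => Set.mem_toFinset.1 (hfG v)⟩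

/-- **Expansion and a 1-factor in Case 1 of the main proof.**
Let `0 < d ≤ 1/100` and `d² ≤ 2c`. If `R` is an oriented graph on `k` vertices with
`δ⁰(R) > (3/8 - 2d)k` and `|N⁺(S)| ≥ |S| + 2ck` for every `S` with `k/3 < |S| < 2k/3`,
then (1) `|N⁺(S)| ≥ |S| + d²k` for every `S` with `d²k < |S| < (1-d²)k`,
(2) `|N⁺(S)| ≥ |S|` for every `S`, and (3) `R` has a 1-factor. -/
theorem expansion_and_one_factor :
    ∀ c d : ℝ, 0 < d → d ≤ 1 / 100 → d ^ 2 ≤ 2 * c →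
    ∀ k : ℕ, ∀ R : Fin k → Fin k → Prop, IsOriented R →
    (∀ i : Fin k, (3 / 8 - 2 * d) * k < (min (outDeg R i) (inDeg R i) : ℝ)) →
    (∀ S : Set (Fin k), (k : ℝ) / 3 < (S.ncard : ℝ) → (S.ncard : ℝ) < 2 * k / 3 →
      (S.ncard : ℝ) + 2 * c * k ≤ ((outNSet R S).ncard : ℝ)) →
    (∀ S : Set (Fin k), d ^ 2 * k < (S.ncard : ℝ) → (S.ncard : ℝ) < (1 - d ^ 2) * k →
      (S.ncard : ℝ) + d ^ 2 * k ≤ ((outNSet R S).ncard : ℝ)) ∧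
    (∀ S : Set (Fin k), S.ncard ≤ (outNSet R S).ncard) ∧
    (∃ σ : Equiv.Perm (Fin k), ∀ v, R v (σ v)) := by
  intro c d hd hd' hc k R _ hdeg hexp
  have hout (i : Fin k) : (3 / 8 - 2 * d) * k < (outDeg R i : ℝ) :=
    (hdeg i).trans_le (min_le_left _ _)
  have hin (i : Fin k) : (3 / 8 - 2 * d) * k < (inDeg R i : ℝ) :=
    (hdeg i).trans_le (min_le_right _ _)
  have hk : (0 : ℝ) ≤ k := k.cast_nonneg
  have hdd : d ^ 2 ≤ 1 / 100 := by nlinarith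
  have hbound : (1 / 3 + d ^ 2) * k ≤ (3 / 8 - 2 * d) * k :=
    mul_le_mul_of_nonneg_right (by linarith) hk
  have hdk : 0 ≤ d ^ 2 * k := by positivity
  have hck : d ^ 2 * k ≤ 2 * c * k := mul_le_mul_of_nonneg_right hc hk
  have hcases (S : Set (Fin k)) (hS : S.Nonempty) :
      (S.ncard : ℝ) + d ^ 2 * k ≤ (outNSet R S).ncard ∨ outNSet R S = Set.univ := by
    rcases le_or_gt (S.ncard : ℝ) (k / 3) with h₁ | h₁
    · left
      linarith [lt_ncard_outNSet_of_forall_lt_outDeg hout hS]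
    rcases lt_or_ge (S.ncard : ℝ) (2 * k / 3) with h₂ | h₂
    · left
      linarith [hexp S h₁ h₂]
    · right
      refine outNSet_eq_univ fun x => ?_
      have hcompl : (S.ncard : ℝ) + Sᶜ.ncard = k := by
        exact_mod_cast (Set.ncard_add_ncard_compl S).trans (Nat.card_fin k)
      have : (Sᶜ.ncard : ℝ) < inDeg R x := by linarith [hin x]
      exact_mod_cast this
  have hhall (S : Set (Fin k)) : S.ncard ≤ (outNSet R S).ncard := by
    rcases S.eq_empty_or_nonempty with rfl | hS
    · simp
    rcases hcases S hS with h | h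
    · have : (S.ncard : ℝ) ≤ (outNSet R S).ncard := by linarith
      exact_mod_cast this
    · exact h ▸ Set.ncard_le_ncard (Set.subset_univ S) (Set.toFinite _)
  refine ⟨fun S h₁ h₂ => ?_, hhall, exists_perm_of_ncard_le_ncard_outNSet hhall⟩
  have hS : S.Nonempty := Set.nonempty_of_ncard_ne_zero fun h => by
    rw [h, Nat.cast_zero] at h₁
    linarith
  rcases hcases S hS with h | h
  · exact h
  · rw [h, Set.ncard_univ, Nat.card_fin]
    linarith

end ArxivOG
end

section
/- Let c ∈ (0,1), let R be an oriented graph on k vertices with δ⁰(R) ≥ 2ck and such that |N⁺_R(S)| ≥ |S| + ck for every nonempty set S of vertices with |S| ≤ (1−c)k, and let 𝒞 be a 1-factor of R. Then for any two vertices x, y of R there is a 𝒞-shifted walk joining x to y which traverses at most ⌈1/c⌉ + 1 cycles of 𝒞. -/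
open Set

namespace ArxivOG

variable {V : Type*}

/-- The possible entry vertices of the last cycle of a shifted walk which starts at `x` and makes
`n` moves between cycles. -/
def shiftedReach (G : V → V → Prop) (ρ : Equiv.Perm V) (x : V) : ℕ → Set V
  | 0 => {x}
  | n + 1 => outNSet G (ρ.symm '' shiftedReach G ρ x n)

theorem exists_walk_of_mem_shiftedReach (G : V → V → Prop) (ρ : Equiv.Perm V) (x : V) (n : ℕ)
    {v : V} (hv : v ∈ shiftedReach G ρ x n) :
    ∃ a : ℕ → V, a 0 = x ∧ a n = v ∧ ∀ i < n, G (ρ.symm (a i)) (a (i + 1)) := by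
  induction n generalizing v with
  | zero => exact ⟨fun _ => x, rfl, (Set.mem_singleton_iff.mp hv).symm, by simp⟩
  | succ n ih =>
    obtain ⟨_, ⟨w, hw, rfl⟩, hwv⟩ := hv
    obtain ⟨a, ha0, han, ha⟩ := ih hw
    refine ⟨fun i => if i ≤ n then a i else v, by simpa using ha0, by simp, fun i hi => ?_⟩
    have hin : i ≤ n := Nat.lt_succ_iff.mp hi
    rcases hin.lt_or_eq with h | rfl
    · simpa [hin, Nat.succ_le_iff.mpr h] using ha i h
    · simpa [han] using hwv

theorem ncard_image_symm (ρ : Equiv.Perm V) (S : Set V) : (ρ.symm '' S).ncard = S.ncard :=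
  Set.ncard_image_of_injective S ρ.symm.injective

/-- If the reachable set is larger than the complement of the in-neighbourhood of
`z`, then `z` is reachable in one more move. -/
theorem mem_shiftedReach_succ [Finite V] (G : V → V → Prop) (ρ : Equiv.Perm V) (x z : V) (n : ℕ)
    (h : Nat.card V < (shiftedReach G ρ x n).ncard + inDeg G z) :
    z ∈ shiftedReach G ρ x (n + 1) := by
  by_contra hz
  have hdisj : Disjoint (ρ.symm '' shiftedReach G ρ x n) (inN G z) :=
    Set.disjoint_left.mpr fun w hw hwz => hz ⟨w, hw, hwz⟩
  have hunion := Set.ncard_union_eq hdisj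
  have hle := Set.ncard_le_card (ρ.symm '' shiftedReach G ρ x n ∪ inN G z)
  rw [ncard_image_symm] at hunion
  unfold inDeg at h
  omega

/-- The reachable sets grow linearly until one of them has more than `(1 - 2c)k` elements. -/
theorem shiftedReach_growth [Finite V] {G : V → V → Prop} {ρ : Equiv.Perm V} {c k : ℝ}
    (hc : 0 < c) (hk : 0 < k) (hdeg : ∀ v, 2 * c * k ≤ outDeg G v)
    (hexp : ∀ S : Set V, S.Nonempty → (S.ncard : ℝ) ≤ (1 - c) * k →
      (S.ncard : ℝ) + c * k ≤ (outNSet G S).ncard)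
    (x : V) (n : ℕ) :
    (∃ m ≤ n + 1, (1 - 2 * c) * k < (shiftedReach G ρ x m).ncard) ∨
      (n + 2) * c * k ≤ (shiftedReach G ρ x (n + 1)).ncard := by
  have hck : 0 < c * k := mul_pos hc hk
  induction n with
  | zero =>
    right
    have : shiftedReach G ρ x (0 + 1) = outN G (ρ.symm x) := by
      ext; simp [shiftedReach, outNSet, outN]
    rw [this]
    simpa [outDeg] using hdeg (ρ.symm x)
  | succ n ih =>
    rcases ih with ⟨m, hm, h⟩ | ih
    · exact Or.inl ⟨m, by omega, h⟩
    by_cases hbig : (1 - 2 * c) * k < (shiftedReach G ρ x (n + 1)).ncard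
    · exact Or.inl ⟨n + 1, by omega, hbig⟩
    right
    have hpos : (0 : ℝ) < (shiftedReach G ρ x (n + 1)).ncard := lt_of_lt_of_le (by positivity) ih
    have hne : (shiftedReach G ρ x (n + 1)).Nonempty :=
      Set.nonempty_of_ncard_ne_zero (by exact_mod_cast hpos.ne')
    have hstep := hexp (ρ.symm '' shiftedReach G ρ x (n + 1)) (hne.image _)
    rw [ncard_image_symm] at hstep
    have hstep := hstep (by linarith)
    rw [show shiftedReach G ρ x (n + 1 + 1) =
      outNSet G (ρ.symm '' shiftedReach G ρ x (n + 1)) from rfl]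
    push_cast
    linarith

/-- **Shifted walks.**
Let `c ∈ (0,1)` and let `R` be an oriented graph on `k` vertices with `δ⁰(R) ≥ 2ck` and
`|N⁺(S)| ≥ |S| + ck` for every nonempty `S` with `|S| ≤ (1-c)k`, and let `𝒞` be a 1-factor
of `R`, encoded by a permutation `ρ` with `R v (ρ v)` for all `v` (so the predecessor of `a`
on its cycle is `ρ⁻¹ a`). Then for any vertices `x, y` there is a `𝒞`-shifted walk from `x`
to `y` traversing at most `⌈1/c⌉ + 1` cycles of `𝒞`; such a walk is determined by the
sequence `a 0, …, a (t-1)` of entry vertices, where `a 0 = x`, `(a (t-1))⁻ = y` and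
`(a i)⁻ → a (i+1)` is an edge of `R` for each `i < t - 1`. -/
theorem shifted_walk_exists :
    ∀ c : ℝ, 0 < c → c < 1 →
    ∀ k : ℕ, ∀ R : Fin k → Fin k → Prop, IsOriented R →
    (∀ v : Fin k, 2 * c * k ≤ (min (outDeg R v) (inDeg R v) : ℝ)) →
    (∀ S : Set (Fin k), S.Nonempty → (S.ncard : ℝ) ≤ (1 - c) * k →
      (S.ncard : ℝ) + c * k ≤ ((outNSet R S).ncard : ℝ)) →
    ∀ ρ : Equiv.Perm (Fin k), (∀ v, R v (ρ v)) →
    ∀ x y : Fin k,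
    ∃ (t : ℕ) (a : ℕ → Fin k),
      1 ≤ t ∧ t ≤ ⌈1 / c⌉₊ + 1 ∧
      a 0 = x ∧ ρ.symm (a (t - 1)) = y ∧
      (∀ i : ℕ, i + 1 < t → R (ρ.symm (a i)) (a (i + 1))) := by
  intro c hc hc1 k R _ hdeg hexp ρ _ x y
  have hk : (0 : ℝ) < k := by exact_mod_cast x.pos
  have hck : 0 < c * k := mul_pos hc hk
  have hceil : 1 ≤ c * ⌈1 / c⌉₊ := by
    have := mul_le_mul_of_nonneg_left (Nat.le_ceil (1 / c)) hc.le
    rwa [mul_one_div_cancel hc.ne'] at this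
  have htwo : 1 < ⌈1 / c⌉₊ := Nat.lt_ceil.mpr (by simpa using one_lt_one_div hc hc1)
  obtain ⟨n, hn⟩ := Nat.exists_eq_add_of_le' htwo
  rw [hn] at hceil ⊢
  have hlarge : ∃ m ≤ n + 1, (1 - 2 * c) * k < (shiftedReach R ρ x m).ncard := by
    rcases shiftedReach_growth (ρ := ρ) hc hk (fun v => (hdeg v).trans (min_le_left _ _))
      hexp x n with h | h
    · exact h
    · refine ⟨n + 1, le_rfl, lt_of_lt_of_le ?_ h⟩
      push_cast at hceil
      nlinarith
  obtain ⟨m, hm, hlarge⟩ := hlarge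
  have hin : 2 * c * k ≤ inDeg R (ρ y) := (hdeg (ρ y)).trans (min_le_right _ _)
  have hmem : ρ y ∈ shiftedReach R ρ x (m + 1) := by
    apply mem_shiftedReach_succ
    rw [Nat.card_fin]
    have : (k : ℝ) < (shiftedReach R ρ x m).ncard + inDeg R (ρ y) := by linarith
    exact_mod_cast this
  obtain ⟨a, ha0, ha, hstep⟩ := exists_walk_of_mem_shiftedReach R ρ x (m + 1) hmem
  exact ⟨m + 2, a, by omega, by omega, ha0, by simp [ha], fun i hi => hstep i (by omega)⟩

end ArxivOG
end

section
/- Let ε ∈ (0,1), d ∈ [0,1], and let G be an oriented graph on n vertices. Let V₀, V₁, …, V_k be a partition of V(G) with |V₀| ≤ εn and |V₁| = … = |V_k| = m, and let G' be a spanning subdigraph of G with d⁺_{G'}(x) > d⁺_G(x) − (d+ε)n and d⁻_{G'}(x) > d⁻_G(x) − (d+ε)n for every vertex x, such that each G'[V_i] is empty. Let R' be the reduced digraph on [k], in which ij ∈ E(R') whenever G' contains a V_i–V_j edge. Then δ⁺(R') > (δ⁺(G)/n − d − 2ε)k and δ⁻(R') > (δ⁻(G)/n − d − 2ε)k. -/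
open Set

namespace ArxivOG

variable {V : Type*}

open Classical in
/-- A union of clusters of common size `m`, indexed by `T`, has `m * |T|` elements. -/
theorem ncard_setOf_exists_cluster [Finite V] {k m : ℕ} (P : V → Option (Fin k))
    (hP : ∀ i, (cluster P i).ncard = m) (T : Set (Fin k)) :
    {x | ∃ j ∈ T, P x = some j}.ncard = m * T.ncard := by
  have := Fintype.ofFinite V
  have hset : {x | ∃ j ∈ T, P x = some j} =
      ↑(T.toFinset.biUnion fun j => (cluster P j).toFinset) := by
    ext x
    simp only [Finset.mem_coe, Finset.mem_biUnion, Set.mem_toFinset]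
    rfl
  rw [hset, Set.ncard_coe_finset, Finset.card_biUnion, Finset.sum_const_nat (m := m),
    Set.ncard_eq_toFinset_card', mul_comm]
  · intro j _
    rw [← hP j, Set.ncard_eq_toFinset_card']
  · intro a _ b _ hab
    refine Finset.disjoint_left.2 fun x hxa hxb => ?_
    have ha : x ∈ cluster P a := Set.mem_toFinset.1 hxa
    have hb : x ∈ cluster P b := Set.mem_toFinset.1 hxb
    exact hab (Option.some.inj ((Eq.symm ha).trans hb))

/-- The outdegree of a vertex of cluster `i` is bounded by the size of the exceptional set plus
the total size of the clusters to which `i` is joined in the reduced digraph. -/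
theorem outDeg_le_ncard_cluster0_add [Finite V] {k m : ℕ} (P : V → Option (Fin k))
    (hP : ∀ i, (cluster P i).ncard = m) {G' : V → V → Prop} {R' : Fin k → Fin k → Prop}
    (hR : ∀ i j, R' i j ↔ ∃ x ∈ cluster P i, ∃ y ∈ cluster P j, G' x y)
    {i : Fin k} {x : V} (hx : x ∈ cluster P i) :
    outDeg G' x ≤ (cluster0 P).ncard + m * outDeg R' i := by
  have hsub : outN G' x ⊆ cluster0 P ∪ {y | ∃ j ∈ outN R' i, P y = some j} := by
    intro y hy
    cases h : P y with
    | none => exact Or.inl h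
    | some j => exact Or.inr ⟨j, (hR i j).2 ⟨x, hx, y, h, hy⟩, h⟩
  calc outDeg G' x ≤ (cluster0 P ∪ {y | ∃ j ∈ outN R' i, P y = some j}).ncard :=
        Set.ncard_le_ncard hsub (Set.toFinite _)
    _ ≤ _ := Set.ncard_union_le _ _
    _ = _ := by rw [ncard_setOf_exists_cluster P hP]; rfl

/-- The minimum outdegree of the reduced digraph. -/
theorem lt_minOutDeg_reduced {ε d : ℝ} (hε : 0 < ε) (hε1 : ε < 1) (hd : 0 ≤ d) {n k m : ℕ}
    (hk : 1 ≤ k) (G : Fin n → Fin n → Prop) (P : Fin n → Option (Fin k))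
    (h0 : ((cluster0 P).ncard : ℝ) ≤ ε * n) (hP : ∀ i, (cluster P i).ncard = m)
    (G' : Fin n → Fin n → Prop)
    (hdeg : ∀ x, (outDeg G x : ℝ) - (d + ε) * n < (outDeg G' x : ℝ))
    (R' : Fin k → Fin k → Prop)
    (hR : ∀ i j, R' i j ↔ ∃ x ∈ cluster P i, ∃ y ∈ cluster P j, G' x y) :
    ((minOutDeg G : ℝ) / n - d - 2 * ε) * k < (minOutDeg R' : ℝ) := by
  have hk0 : (0 : ℝ) < k := by exact_mod_cast hk
  set c : ℝ := (minOutDeg G : ℝ) / n - d - 2 * ε with hc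
  have hr0 : (0 : ℝ) ≤ minOutDeg R' := Nat.cast_nonneg _
  rcases lt_or_ge c 0 with hneg | hnonneg
  · exact (mul_neg_of_neg_of_pos hneg hk0).trans_le hr0
  have hn : (0 : ℝ) < n := by
    rcases Nat.eq_zero_or_pos n with rfl | hn
    · simp only [Nat.cast_zero, div_zero] at hc
      linarith
    · exact_mod_cast hn
  have hclusters : m * k ≤ n := by
    have h := ncard_setOf_exists_cluster P hP Set.univ
    rw [Set.ncard_univ, Nat.card_fin] at h
    rw [← h]
    simpa using Set.ncard_le_card {x | ∃ j ∈ Set.univ, P x = some j}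
  have hm : 0 < m := by
    rw [Nat.pos_iff_ne_zero]
    rintro rfl
    have huniv : cluster0 P = Set.univ := by
      refine Set.eq_univ_of_forall fun x => ?_
      cases h : P x with
      | none => exact h
      | some j =>
        have hj : cluster P j = ∅ := (Set.ncard_eq_zero (Set.toFinite _)).1 (hP j)
        exact absurd (show x ∈ cluster P j from h) (by simp [hj])
    rw [huniv, Set.ncard_univ, Nat.card_fin] at h0
    nlinarith
  have : Nonempty (Fin k) := ⟨⟨0, hk⟩⟩
  obtain ⟨i, hi⟩ : minOutDeg R' ∈ Set.range (outDeg R') := Nat.sInf_mem (Set.range_nonempty _)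
  obtain ⟨x, hx⟩ : (cluster P i).Nonempty :=
    Set.nonempty_of_ncard_ne_zero (by rw [hP i]; exact hm.ne')
  have hcount : (outDeg G' x : ℝ) ≤ (cluster0 P).ncard + m * minOutDeg R' := by
    rw [← hi]
    exact_mod_cast outDeg_le_ncard_cluster0_add P hP hR hx
  have hmin : (minOutDeg G : ℝ) ≤ outDeg G x := by
    exact_mod_cast Nat.sInf_le (Set.mem_range_self x)
  have hcn : c * n = minOutDeg G - (d + 2 * ε) * n := by
    rw [hc]
    field_simp
    ring
  have hm' : (0 : ℝ) < m := by exact_mod_cast hm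
  have hmk : (m : ℝ) * k ≤ n := by exact_mod_cast hclusters
  refine lt_of_mul_lt_mul_left ?_ hm'.le
  calc (m : ℝ) * (c * k) = c * (m * k) := by ring
    _ ≤ c * n := mul_le_mul_of_nonneg_left hmk hnonneg
    _ < m * minOutDeg R' := by linarith [hdeg x]

/-- **The reduced digraph inherits the minimum degrees.**
Let `ε ∈ (0,1)`, `d ∈ [0,1]`, `G` an oriented graph on `n` vertices with a partition
`V₀, V₁, …, V_k` (encoded by `P`, with `|V₀| ≤ εn` and all clusters of size `m`), and `G'` a
spanning subdigraph with the usual degree conditions and `G'[V_i]` empty. If `R'` is the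
digraph on `[k]` with `ij ∈ E(R')` whenever `G'` contains a `V_i`–`V_j` edge, then
`δ⁺(R') > (δ⁺(G)/n - d - 2ε)k` and `δ⁻(R') > (δ⁻(G)/n - d - 2ε)k`. -/
theorem reduced_digraph_inherits_min_degree :
    ∀ ε d : ℝ, 0 < ε → ε < 1 → 0 ≤ d → d ≤ 1 →
    ∀ n k m : ℕ, 1 ≤ k →
    ∀ G : Fin n → Fin n → Prop, IsOriented G →
    ∀ P : Fin n → Option (Fin k),
    ((cluster0 P).ncard : ℝ) ≤ ε * n →
    (∀ i : Fin k, (cluster P i).ncard = m) →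
    ∀ G' : Fin n → Fin n → Prop,
    (∀ x y, G' x y → G x y) →
    (∀ x, (outDeg G x : ℝ) - (d + ε) * n < (outDeg G' x : ℝ)) →
    (∀ x, (inDeg G x : ℝ) - (d + ε) * n < (inDeg G' x : ℝ)) →
    (∀ i : Fin k, ∀ x ∈ cluster P i, ∀ y ∈ cluster P i, ¬ G' x y) →
    ∀ R' : Fin k → Fin k → Prop,
    (∀ i j : Fin k, R' i j ↔ ∃ x ∈ cluster P i, ∃ y ∈ cluster P j, G' x y) →
    ((minOutDeg G : ℝ) / n - d - 2 * ε) * k < (minOutDeg R' : ℝ) ∧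
    ((minInDeg G : ℝ) / n - d - 2 * ε) * k < (minInDeg R' : ℝ) := by
  intro ε d hε hε1 hd _ n k m hk G _ P h0 hP G' _ hout hin _ R' hR
  refine ⟨lt_minOutDeg_reduced hε hε1 hd hk G P h0 hP G' hout R' hR,
    lt_minOutDeg_reduced hε hε1 hd hk (flip G) P h0 hP (flip G') hin (flip R') fun i j => ?_⟩
  refine (hR j i).trans ⟨?_, ?_⟩ <;> exact fun ⟨x, hx, y, hy, h⟩ => ⟨y, hy, x, hx, h⟩

end ArxivOG
end
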